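/- arXiv:math/0609583 — 2 statements merged into one kernel-verified Lean document; each statement's English description precedes it below -/
import Mathlib

section
/- Let I be an arbitrary two-sided ideal of R and A = R/I. With respect to the Γ-filtration FA of A induced by the Γ-grading filtration FR of R, there is an isomorphism of Γ-graded K-algebras G(A) ≅ R/⟨HT(I)⟩. More precisely, for each γ ∈ Γ the natural K-linear map φ_γ: R_γ → G(A)_γ = F_γA/F*_γA (sending a homogeneous element of degree γ to the class of its image in A) is surjective with kernel Ker φ_γ = ⟨HT(I)⟩ ∩ R_γ = ((I ∩ F_γR) + F*_γR) ∩ R_γ, and the maps φ_γ assemble to a Γ-graded K-algebra epimorphism φ: R → G(A) with Ker φ = ⟨HT(I)⟩. -/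
/-!
STATEMENT 0.  Γ is a totally ordered semigroup (order compatible with
multiplication on both sides), R = ⊕_{γ∈Γ} R_γ a Γ-graded K-algebra,
I a two-sided ideal of R and A = R/I (presented by a surjective K-algebra
map p : R → A with kernel I).  With respect to the Γ-filtration of A induced
by the Γ-grading filtration of R, the associated Γ-graded algebra G(A)
(axiomatised below by the structure `AssocGradedOfQuot`) satisfies
G(A) ≅ R/⟨HT(I)⟩: there is a Γ-graded K-algebra epimorphism φ : R → G(A),
restricting on each R_γ to the natural map φ_γ (sending a homogeneous element
r of degree γ to the class σ_γ(p r) of its image in A), whose kernel is the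
two-sided ideal generated by the head terms of I, with
Ker φ_γ = ⟨HT(I)⟩ ∩ R_γ = ((I ∩ F_γR) + F*_γR) ∩ R_γ for every γ.
-/

open Function

universe u v w x

variable (K : Type u) [Field K] (Γ : Type v) [Semigroup Γ] [LinearOrder Γ]

/-- The two-sided ideal (as a `K`-subspace, automatically an ideal) of `R`
generated by a subset `S`. -/
def twoSidedSpan (R : Type w) [Ring R] [Algebra K R] (S : Set R) : Submodule K R :=
  sInf {J : Submodule K R | S ⊆ J ∧ ∀ r : R, ∀ x ∈ J, r * x ∈ J ∧ x * r ∈ J}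

variable {R : Type w} [Ring R] [Algebra K R]

/-- `ℛ` is a `Γ`-grading of the `K`-algebra `R`: `R = ⊕_γ R_γ` with
`R_{γ₁}·R_{γ₂} ⊆ R_{γ₁γ₂}`. -/
structure IsAlgGrading [DecidableEq Γ] (ℛ : Γ → Submodule K R) : Prop where
  internal : DirectSum.IsInternal ℛ
  mul_mem : ∀ {γ₁ γ₂ : Γ} {x y : R}, x ∈ ℛ γ₁ → y ∈ ℛ γ₂ → x * y ∈ ℛ (γ₁ * γ₂)

/-- The Γ-grading filtration `F_γR = ⊕_{γ'≼γ} R_{γ'}` of `R`. -/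
def gradeFil (ℛ : Γ → Submodule K R) (γ : Γ) : Submodule K R := ⨆ γ' ≤ γ, ℛ γ'

/-- `F*_γR = ⋃_{γ'≺γ} F_{γ'}R` (equivalently, the sum of all `R_{γ'}` with `γ' ≺ γ`). -/
def gradeFilStar (ℛ : Γ → Submodule K R) (γ : Γ) : Submodule K R := ⨆ γ' < γ, ℛ γ'

/-- `IsHT ℛ f h γ` : `h` is the head term of `f`, of degree `γ`; that is, `h` is the
nonzero homogeneous component of `f` of ≺-largest degree `γ`. -/
def IsHT (ℛ : Γ → Submodule K R) (f h : R) (γ : Γ) : Prop :=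
  h ∈ ℛ γ ∧ h ≠ 0 ∧ f - h ∈ gradeFilStar K Γ ℛ γ

/-- The set of head terms of elements of `S`. -/
def HTset (ℛ : Γ → Submodule K R) (S : Set R) : Set R :=
  {h | ∃ f ∈ S, ∃ γ, IsHT K Γ ℛ f h γ}

variable (ℛ : Γ → Submodule K R)

/-- The Γ-filtration of `A = R/I` induced by the grading filtration of `R`:
`F_γA = (F_γR + I)/I = p(F_γR)`. -/
def quotFil {A : Type x} [Ring A] [Algebra K A] (p : R →ₐ[K] A) (γ : Γ) : Submodule K A :=
  (gradeFil K Γ ℛ γ).map p.toLinearMap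

/-- `F*_γA = ⋃_{γ'≺γ} F_{γ'}A`. -/
def quotFilStar {A : Type x} [Ring A] [Algebra K A] (p : R →ₐ[K] A) (γ : Γ) : Submodule K A :=
  ⨆ γ' < γ, quotFil K Γ ℛ p γ'

/-- Axiomatisation of the associated Γ-graded K-algebra `G(A)` of `A = R/I`
with respect to the induced Γ-filtration `F_γA = p(F_γR)`:  `B` together with a
Γ-grading `grade` and, for each `γ`, the canonical `K`-linear map
`σ γ : F_γA → G(A)` onto the γ-component `G(A)_γ = F_γA/F*_γA` (with kernel
`F*_γA`), multiplicative and compatible with the grading.  Any two algebras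
carrying such data are canonically isomorphic as Γ-graded K-algebras, so this
is a faithful rendering of `G(A)`. -/
structure AssocGradedOfQuot [DecidableEq Γ] {A : Type x} [Ring A] [Algebra K A]
    (p : R →ₐ[K] A) (B : Type*) [Ring B] [Algebra K B] where
  grade : Γ → Submodule K B
  internal : DirectSum.IsInternal grade
  σ : ∀ γ : Γ, (quotFil K Γ ℛ p γ) →ₗ[K] B
  σ_mem : ∀ (γ : Γ) (a : quotFil K Γ ℛ p γ), σ γ a ∈ grade γ
  σ_surj : ∀ γ : Γ, ∀ b ∈ grade γ, ∃ a : quotFil K Γ ℛ p γ, σ γ a = b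
  σ_ker : ∀ (γ : Γ) (a : quotFil K Γ ℛ p γ), σ γ a = 0 ↔ (a : A) ∈ quotFilStar K Γ ℛ p γ
  σ_mul : ∀ {γ₁ γ₂ : Γ} (a : quotFil K Γ ℛ p γ₁) (b : quotFil K Γ ℛ p γ₂)
    (h : (a : A) * (b : A) ∈ quotFil K Γ ℛ p (γ₁ * γ₂)),
    σ γ₁ a * σ γ₂ b = σ (γ₁ * γ₂) ⟨(a : A) * (b : A), h⟩

section FiltrationLemmas

variable {K Γ} {ℛ}

lemma mem_twoSidedSpan_of_mem {S : Set R} {x : R} (hx : x ∈ S) : x ∈ twoSidedSpan K R S :=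
  Submodule.mem_sInf.2 fun _ hJ => hJ.1 hx

lemma twoSidedSpan_le {S : Set R} {J : Submodule K R} (hS : S ⊆ J)
    (hJ : ∀ r : R, ∀ x ∈ J, r * x ∈ J ∧ x * r ∈ J) : twoSidedSpan K R S ≤ J :=
  sInf_le ⟨hS, hJ⟩

omit [Semigroup Γ] in
lemma le_gradeFil (γ : Γ) : ℛ γ ≤ gradeFil K Γ ℛ γ :=
  le_iSup₂_of_le (f := fun γ' (_ : γ' ≤ γ) => ℛ γ') γ le_rfl le_rfl

omit [Semigroup Γ] in
lemma gradeFil_le_gradeFilStar {γ' γ : Γ} (h : γ' < γ) :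
    gradeFil K Γ ℛ γ' ≤ gradeFilStar K Γ ℛ γ :=
  iSup₂_le fun δ hδ =>
    le_iSup₂_of_le (f := fun γ' (_ : γ' < γ) => ℛ γ') δ (hδ.trans_lt h) le_rfl

omit [Semigroup Γ] in
lemma gradeFilStar_le_gradeFil (γ : Γ) : gradeFilStar K Γ ℛ γ ≤ gradeFil K Γ ℛ γ :=
  iSup₂_le fun δ hδ => le_iSup₂_of_le (f := fun γ' (_ : γ' ≤ γ) => ℛ γ') δ hδ.le le_rfl

omit [Semigroup Γ] in
lemma gradeFil_eq_sup (γ : Γ) :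
    gradeFil K Γ ℛ γ = ℛ γ ⊔ gradeFilStar K Γ ℛ γ := by
  refine le_antisymm (iSup₂_le fun δ hδ => ?_)
    (sup_le (le_gradeFil γ) (gradeFilStar_le_gradeFil γ))
  rcases hδ.eq_or_lt with rfl | h
  · exact le_sup_left
  · exact ((le_gradeFil δ).trans (gradeFil_le_gradeFilStar h)).trans le_sup_right

omit [Semigroup Γ] in
lemma iSup_gradeFil_eq_gradeFilStar (γ : Γ) :
    ⨆ γ' < γ, gradeFil K Γ ℛ γ' = gradeFilStar K Γ ℛ γ :=
  le_antisymm (iSup₂_le fun _ h => gradeFil_le_gradeFilStar h)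
    (iSup₂_mono fun γ' _ => le_gradeFil γ')

variable {A : Type x} [Ring A] [Algebra K A] {p : R →ₐ[K] A}

omit [Semigroup Γ] in
lemma quotFilStar_eq_map (γ : Γ) :
    quotFilStar K Γ ℛ p γ = (gradeFilStar K Γ ℛ γ).map p.toLinearMap := by
  simp only [quotFilStar, quotFil, ← Submodule.map_iSup, iSup_gradeFil_eq_gradeFilStar]

omit [Semigroup Γ] in
lemma map_mem_quotFil {γ : Γ} {r : R} (hr : r ∈ ℛ γ) : p r ∈ quotFil K Γ ℛ p γ :=
  Submodule.mem_map_of_mem (f := p.toLinearMap) (le_gradeFil γ hr)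

omit [Semigroup Γ] in
lemma map_mem_quotFilStar_iff {I : Submodule K R} (hker : ∀ x : R, p x = 0 ↔ x ∈ I)
    {γ : Γ} {r : R} :
    p r ∈ quotFilStar K Γ ℛ p γ ↔ ∃ s ∈ gradeFilStar K Γ ℛ γ, r - s ∈ I := by
  simp only [quotFilStar_eq_map, Submodule.mem_map, ← hker, map_sub, sub_eq_zero,
    AlgHom.toLinearMap_apply, eq_comm (a := p r)]

omit [Semigroup Γ] in
lemma mem_inf_add_gradeFilStar_iff {I : Submodule K R} {γ : Γ} {r : R} (hr : r ∈ ℛ γ) :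
    r ∈ (I ⊓ gradeFil K Γ ℛ γ) + gradeFilStar K Γ ℛ γ ↔
      ∃ s ∈ gradeFilStar K Γ ℛ γ, r - s ∈ I := by
  rw [Submodule.add_eq_sup, Submodule.mem_sup]
  constructor
  · rintro ⟨i, hi, s, hs, rfl⟩
    exact ⟨s, hs, by simpa using hi.1⟩
  · rintro ⟨s, hs, hI⟩
    exact ⟨r - s, ⟨hI, sub_mem (le_gradeFil γ hr) (gradeFilStar_le_gradeFil γ hs)⟩, s, hs,
      sub_add_cancel r s⟩

omit [Semigroup Γ] in
/-- A homogeneous element congruent modulo `I` to an element of smaller degree is zero or a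
head term of `I`. -/
lemma mem_twoSidedSpan_HTset {I : Submodule K R} {γ : Γ} {r s : R} (hr : r ∈ ℛ γ)
    (hs : s ∈ gradeFilStar K Γ ℛ γ) (hI : r - s ∈ I) :
    r ∈ twoSidedSpan K R (HTset K Γ ℛ I) := by
  by_cases h0 : r = 0
  · exact h0 ▸ zero_mem _
  · exact mem_twoSidedSpan_of_mem ⟨r - s, hI, γ, hr, h0, by simpa using hs⟩

end FiltrationLemmas

section NaturalMap

variable {K Γ} {ℛ} [DecidableEq Γ] {A : Type x} [Ring A] [Algebra K A] {p : R →ₐ[K] A}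
  {B : Type*} [Ring B] [Algebra K B]

namespace AssocGradedOfQuot

lemma mk_eq (GA : AssocGradedOfQuot K Γ ℛ p B) {γ : Γ} {a b : quotFil K Γ ℛ p γ}
    (h : (a : A) - b ∈ quotFilStar K Γ ℛ p γ) : GA.σ γ a = GA.σ γ b := by
  rw [← sub_eq_zero, ← map_sub]
  exact (GA.σ_ker γ (a - b)).2 h

/-- The natural map `R_γ → G(A)_γ`. -/
noncomputable def component (GA : AssocGradedOfQuot K Γ ℛ p B) (γ : Γ) :
    ℛ γ →ₗ[K] GA.grade γ :=
  ((GA.σ γ).codRestrict (GA.grade γ) (GA.σ_mem γ)).comp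
    (p.toLinearMap.restrict fun _ hr => map_mem_quotFil hr)

lemma coe_component (GA : AssocGradedOfQuot K Γ ℛ p B) {γ : Γ} (r : ℛ γ) :
    (GA.component γ r : B) = GA.σ γ ⟨p r, map_mem_quotFil r.2⟩ :=
  rfl

lemma component_surjective (GA : AssocGradedOfQuot K Γ ℛ p B) (γ : Γ) :
    Surjective (GA.component γ) := by
  rintro ⟨b, hb⟩
  obtain ⟨⟨a, ha⟩, rfl⟩ := GA.σ_surj γ b hb
  obtain ⟨f, hf, rfl⟩ := ha
  obtain ⟨r, hr, s, hs, rfl⟩ := Submodule.mem_sup.1 ((gradeFil_eq_sup γ).le hf)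
  refine ⟨⟨r, hr⟩, Subtype.ext (GA.mk_eq ?_)⟩
  rw [quotFilStar_eq_map]
  refine ⟨-s, neg_mem hs, ?_⟩
  change p (-s) = p r - p (r + s)
  simp

/-- The natural maps `R_γ → G(A)_γ` assembled into a `K`-linear map `R → G(A)`. -/
noncomputable def naturalMap (GA : AssocGradedOfQuot K Γ ℛ p B)
    (hℛ : DirectSum.IsInternal ℛ) : R →ₗ[K] B :=
  DirectSum.coeLinearMap GA.grade ∘ₗ DirectSum.lmap GA.component ∘ₗ
    (LinearEquiv.ofBijective (DirectSum.coeLinearMap ℛ) hℛ).symm.toLinearMap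

lemma naturalMap_coeLinearMap (GA : AssocGradedOfQuot K Γ ℛ p B)
    (hℛ : DirectSum.IsInternal ℛ) (x : DirectSum Γ fun γ => ℛ γ) :
    GA.naturalMap hℛ (DirectSum.coeLinearMap ℛ x) =
      DirectSum.coeLinearMap GA.grade (DirectSum.lmap GA.component x) := by
  have h := (LinearEquiv.ofBijective (DirectSum.coeLinearMap ℛ) hℛ).symm_apply_apply x
  exact congrArg (DirectSum.coeLinearMap GA.grade ∘ₗ DirectSum.lmap GA.component) h

lemma naturalMap_coe (GA : AssocGradedOfQuot K Γ ℛ p B)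
    (hℛ : DirectSum.IsInternal ℛ) {γ : Γ} (r : ℛ γ) :
    GA.naturalMap hℛ r = GA.component γ r := by
  have h := GA.naturalMap_coeLinearMap hℛ (DirectSum.lof K Γ (fun γ => ℛ γ) γ r)
  simpa [DirectSum.lmap_lof, DirectSum.coeLinearMap_lof] using h

lemma naturalMap_surjective (GA : AssocGradedOfQuot K Γ ℛ p B)
    (hℛ : DirectSum.IsInternal ℛ) :
    Surjective (GA.naturalMap hℛ) :=
  GA.internal.2.comp (((DirectSum.lmap_surjective _).2 GA.component_surjective).comp (LinearEquiv.surjective _))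

lemma naturalMap_mul (GA : AssocGradedOfQuot K Γ ℛ p B) (hgr : IsAlgGrading K Γ ℛ) (x y : R) :
    GA.naturalMap hgr.internal (x * y) =
      GA.naturalMap hgr.internal x * GA.naturalMap hgr.internal y := by
  have htop : ∀ z : R, z ∈ ⨆ γ, ℛ γ := fun z =>
    hgr.internal.submodule_iSup_eq_top ▸ Submodule.mem_top
  refine Submodule.iSup_induction ℛ (motive := fun x => GA.naturalMap hgr.internal (x * y) =
      GA.naturalMap hgr.internal x * GA.naturalMap hgr.internal y) (htop x) ?_ (by simp) ?_
  · intro γ₁ a ha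
    refine Submodule.iSup_induction ℛ (motive := fun y => GA.naturalMap hgr.internal (a * y) =
      GA.naturalMap hgr.internal a * GA.naturalMap hgr.internal y) (htop y) ?_ (by simp) ?_
    · intro γ₂ b hb
      have hab := hgr.mul_mem ha hb
      have hp : p a * p b ∈ quotFil K Γ ℛ p (γ₁ * γ₂) := map_mul p a b ▸ map_mem_quotFil hab
      rw [GA.naturalMap_coe hgr.internal ⟨a, ha⟩, GA.naturalMap_coe hgr.internal ⟨b, hb⟩,
        GA.naturalMap_coe hgr.internal ⟨a * b, hab⟩, coe_component, coe_component,
        coe_component, GA.σ_mul _ _ hp]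
      congr 2
      exact map_mul p a b
    · intro u v hu hv
      rw [mul_add, map_add, map_add, hu, hv, mul_add]
  · intro u v hu hv
    rw [add_mul, map_add, map_add, hu, hv, add_mul]

/-- The natural map as a homomorphism of algebras; it is unital because it is surjective. -/
noncomputable def naturalAlgHom (GA : AssocGradedOfQuot K Γ ℛ p B) (hgr : IsAlgGrading K Γ ℛ) :
    R →ₐ[K] B :=
  AlgHom.ofLinearMap (GA.naturalMap hgr.internal)
    (by
      obtain ⟨e, he⟩ := GA.naturalMap_surjective hgr.internal 1
      have h := GA.naturalMap_mul hgr 1 e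
      rwa [one_mul, he, mul_one, eq_comm] at h)
    (GA.naturalMap_mul hgr)

lemma component_eq_zero_iff (GA : AssocGradedOfQuot K Γ ℛ p B) {I : Submodule K R}
    (hker : ∀ x : R, p x = 0 ↔ x ∈ I) {γ : Γ} (r : ℛ γ) :
    GA.component γ r = 0 ↔ ∃ s ∈ gradeFilStar K Γ ℛ γ, (r : R) - s ∈ I := by
  rw [← map_mem_quotFilStar_iff hker, ← Submodule.coe_eq_zero, coe_component, GA.σ_ker]

lemma mem_twoSidedSpan_of_naturalMap_eq_zero (GA : AssocGradedOfQuot K Γ ℛ p B)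
    (hℛ : DirectSum.IsInternal ℛ) {I : Submodule K R} (hker : ∀ x : R, p x = 0 ↔ x ∈ I)
    {x : R} (hx : GA.naturalMap hℛ x = 0) : x ∈ twoSidedSpan K R (HTset K Γ ℛ I) := by
  classical
  obtain ⟨x, rfl⟩ := hℛ.2 x
  change GA.naturalMap hℛ (DirectSum.coeLinearMap ℛ x) = 0 at hx
  rw [naturalMap_coeLinearMap] at hx
  have h0 : DirectSum.lmap GA.component x = 0 :=
    GA.internal.1 (hx.trans (map_zero (DirectSum.coeLinearMap GA.grade)).symm)
  change DirectSum.coeLinearMap ℛ x ∈ _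
  rw [DirectSum.coeLinearMap_eq_dfinsuppSum]
  refine dfinsuppSum_mem _ _ _ fun γ _ => ?_
  have hγ : GA.component γ (x γ) = 0 := by
    rw [← DirectSum.lmap_apply, h0, DirectSum.zero_apply]
  obtain ⟨s, hs, hI⟩ := (GA.component_eq_zero_iff hker _).1 hγ
  exact mem_twoSidedSpan_HTset (x γ).2 hs hI

end AssocGradedOfQuot

end NaturalMap

theorem statement0 [DecidableEq Γ]
    [CovariantClass Γ Γ (· * ·) (· < ·)] [CovariantClass Γ Γ (swap (· * ·)) (· < ·)]
    (hgr : IsAlgGrading K Γ ℛ)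
    -- I is a two-sided ideal of R (a K-subspace closed under multiplication by R)
    (I : Submodule K R) (hI : ∀ r : R, ∀ x ∈ I, r * x ∈ I ∧ x * r ∈ I)
    -- A = R/I, presented by a surjective K-algebra map p with kernel I
    (A : Type x) [Ring A] [Algebra K A] (p : R →ₐ[K] A) (hp : Surjective p)
    (hker : ∀ x : R, p x = 0 ↔ x ∈ I)
    -- G(A), the associated Γ-graded algebra of A w.r.t. the induced filtration
    (B : Type*) [Ring B] [Algebra K B] (GA : AssocGradedOfQuot K Γ ℛ p B) :
    ∃ φ : R →ₐ[K] B,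
      -- φ is an epimorphism of Γ-graded K-algebras
      Surjective φ ∧
      (∀ γ : Γ, (ℛ γ).map φ.toLinearMap = GA.grade γ) ∧
      -- on each R_γ, φ is the natural map φ_γ : r ↦ σ_γ(class of p r)
      (∀ (γ : Γ) (r : R), r ∈ ℛ γ → ∀ h : p r ∈ quotFil K Γ ℛ p γ,
        φ r = GA.σ γ ⟨p r, h⟩) ∧
      -- Ker φ = ⟨HT(I)⟩
      (∀ x : R, φ x = 0 ↔ x ∈ twoSidedSpan K R (HTset K Γ ℛ I)) ∧
      -- for each γ: Ker φ_γ = ⟨HT(I)⟩ ∩ R_γ = ((I ∩ F_γR) + F*_γR) ∩ R_γ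
      (∀ γ : Γ, ∀ r ∈ ℛ γ,
        (φ r = 0 ↔ r ∈ twoSidedSpan K R (HTset K Γ ℛ I) ⊓ ℛ γ) ∧
        (φ r = 0 ↔ r ∈ (I ⊓ gradeFil K Γ ℛ γ) + gradeFilStar K Γ ℛ γ)) := by
  let φ := GA.naturalAlgHom hgr
  have hφ (γ : Γ) (r : ℛ γ) : φ r = GA.component γ r := GA.naturalMap_coe hgr.internal r
  have hφ0 (γ : Γ) (r : R) (hr : r ∈ ℛ γ) :
      φ r = 0 ↔ ∃ s ∈ gradeFilStar K Γ ℛ γ, r - s ∈ I := by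
    rw [hφ γ ⟨r, hr⟩, Submodule.coe_eq_zero, GA.component_eq_zero_iff hker]
  have hφker (x : R) : φ x = 0 ↔ x ∈ twoSidedSpan K R (HTset K Γ ℛ I) := by
    refine ⟨GA.mem_twoSidedSpan_of_naturalMap_eq_zero hgr.internal hker, fun hx => ?_⟩
    refine twoSidedSpan_le (J := LinearMap.ker φ.toLinearMap) ?_ ?_ hx
    · rintro h ⟨f, hf, γ, hh, -, hlt⟩
      exact (hφ0 γ h hh).2 ⟨h - f, neg_sub f h ▸ neg_mem hlt, by simpa using hf⟩
    · intro r y hy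
      have hy' : φ y = 0 := hy
      exact ⟨by simp [hy'], by simp [hy']⟩
  refine ⟨φ, GA.naturalMap_surjective hgr.internal, fun γ => ?_, fun γ r hr _ => hφ γ ⟨r, hr⟩,
    hφker, fun γ r hr => ⟨?_, ?_⟩⟩
  · refine le_antisymm ?_ fun b hb => ?_
    · rintro _ ⟨r, hr, rfl⟩
      exact (hφ γ ⟨r, hr⟩).symm ▸ (GA.component γ ⟨r, hr⟩).2
    · obtain ⟨r, hr⟩ := GA.component_surjective γ ⟨b, hb⟩
      exact ⟨r, r.2, (hφ γ r).trans (congrArg Subtype.val hr)⟩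
  · rw [hφker, Submodule.mem_inf, and_iff_left hr]
  · rw [hφ0 γ r hr, mem_inf_add_gradeFilStar_iff hr]
end

section
/- Let A be a Γ-filtered K-algebra with Γ-filtration FA and associated Γ-graded algebra G(A). (i) If G(A) is Γ-graded simple (has no two-sided ideal other than 0 and G(A) among Γ-graded ideals), then A is a simple K-algebra. (ii) If M is a Γ-filtered A-module such that G(M) is a Γ-graded simple G(A)-module (has no Γ-graded G(A)-submodule other than 0 and G(M)), then M is a simple A-module. (iii) If G(A) is semisimple Artinian, then A is semisimple Artinian; if G(A) is simple Artinian, then A is simple Artinian. -/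
/-!
Common setting for the lifting results: K a field; Γ an ordered monoid whose
order ≺ is a well-order, compatible with multiplication on both sides, and
whose identity element is the smallest element (the latter is the hypothesis
`(hone : ∀ γ : Γ, 1 ≤ γ)` in the theorem below).
`AlgFiltration K Γ A` is a Γ-filtration FA of the K-algebra A;
`AssocGraded FA B` axiomatises "B is the associated Γ-graded K-algebra G(A)":
it records the Γ-grading of B and, for each γ, the canonical K-linear map
σ γ : F_γA → G(A) onto the component G(A)_γ = F_γA/F*_γA (surjective onto
`grade γ`, with kernel F*_γA), multiplicative and unital.  These data
determine B up to a canonical isomorphism of Γ-graded K-algebras, so the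
structure is a faithful rendering of G(A).  Similarly `ModFiltration` and
`AssocGradedMod` render Γ-filtered A-modules and their associated Γ-graded
G(A)-modules.
-/

open Function

universe u v w x y

variable (K : Type u) [Field K] (Γ : Type v) [Monoid Γ] [LinearOrder Γ]

/-- A Γ-filtration of the K-algebra `A`. -/
structure AlgFiltration (A : Type w) [Ring A] [Algebra K A] where
  F : Γ → Submodule K A
  mono : Monotone F
  exhaustive : ∀ a : A, ∃ γ, a ∈ F γ
  mul_mem : ∀ {γ₁ γ₂ : Γ} {a b : A}, a ∈ F γ₁ → b ∈ F γ₂ → a * b ∈ F (γ₁ * γ₂)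
  one_mem : (1 : A) ∈ F 1

/-- `F*_γA = ⋃_{γ'≺γ} F_{γ'}A`. -/
def AlgFiltration.Fstar {K : Type u} [Field K] {Γ : Type v} [Monoid Γ] [LinearOrder Γ]
    {A : Type w} [Ring A] [Algebra K A]
    (FA : AlgFiltration K Γ A) (γ : Γ) : Submodule K A := ⨆ γ' < γ, FA.F γ'

/-- Axiomatisation of "`B` is the associated Γ-graded K-algebra `G(A)` of the
Γ-filtered K-algebra `A`". -/
structure AssocGraded [DecidableEq Γ] {A : Type w} [Ring A] [Algebra K A]
    (FA : AlgFiltration K Γ A) (B : Type x) [Ring B] [Algebra K B] where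
  grade : Γ → Submodule K B
  internal : DirectSum.IsInternal grade
  σ : ∀ γ : Γ, (FA.F γ) →ₗ[K] B
  σ_mem : ∀ (γ : Γ) (a : FA.F γ), σ γ a ∈ grade γ
  σ_surj : ∀ γ : Γ, ∀ b ∈ grade γ, ∃ a : FA.F γ, σ γ a = b
  σ_ker : ∀ (γ : Γ) (a : FA.F γ), σ γ a = 0 ↔ (a : A) ∈ FA.Fstar γ
  σ_mul : ∀ {γ₁ γ₂ : Γ} (a : FA.F γ₁) (b : FA.F γ₂),
    σ γ₁ a * σ γ₂ b = σ (γ₁ * γ₂) ⟨(a : A) * (b : A), FA.mul_mem a.2 b.2⟩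
  σ_one : σ 1 ⟨1, FA.one_mem⟩ = 1

/-- A Γ-filtration of the A-module `M`, compatible with the Γ-filtration `FA`. -/
structure ModFiltration {A : Type w} [Ring A] [Algebra K A] (FA : AlgFiltration K Γ A)
    (M : Type x) [AddCommGroup M] [Module K M] [Module A M] [IsScalarTower K A M] where
  F : Γ → Submodule K M
  mono : Monotone F
  exhaustive : ∀ m : M, ∃ γ, m ∈ F γ
  smul_mem : ∀ {γ₁ γ₂ : Γ} {a : A} {m : M}, a ∈ FA.F γ₁ → m ∈ F γ₂ → a • m ∈ F (γ₁ * γ₂)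

/-- `F*_γM = ⋃_{γ'≺γ} F_{γ'}M`. -/
def ModFiltration.Fstar {K : Type u} [Field K] {Γ : Type v} [Monoid Γ] [LinearOrder Γ]
    {A : Type w} [Ring A] [Algebra K A] {FA : AlgFiltration K Γ A}
    {M : Type x} [AddCommGroup M] [Module K M] [Module A M] [IsScalarTower K A M]
    (FM : ModFiltration K Γ FA M) (γ : Γ) : Submodule K M := ⨆ γ' < γ, FM.F γ'

/-- Axiomatisation of "`N` is the associated Γ-graded `G(A)`-module `G(M)` of
the Γ-filtered A-module `M`", where `B = G(A)` via `GA`. -/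
structure AssocGradedMod [DecidableEq Γ] {A : Type w} [Ring A] [Algebra K A]
    {FA : AlgFiltration K Γ A} {B : Type x} [Ring B] [Algebra K B]
    (GA : AssocGraded K Γ FA B)
    {M : Type y} [AddCommGroup M] [Module K M] [Module A M] [IsScalarTower K A M]
    (FM : ModFiltration K Γ FA M)
    (N : Type*) [AddCommGroup N] [Module K N] [Module B N] [IsScalarTower K B N] where
  grade : Γ → Submodule K N
  internal : DirectSum.IsInternal grade
  σ : ∀ γ : Γ, (FM.F γ) →ₗ[K] N
  σ_mem : ∀ (γ : Γ) (m : FM.F γ), σ γ m ∈ grade γ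
  σ_surj : ∀ γ : Γ, ∀ y ∈ grade γ, ∃ m : FM.F γ, σ γ m = y
  σ_ker : ∀ (γ : Γ) (m : FM.F γ), σ γ m = 0 ↔ (m : M) ∈ FM.Fstar γ
  σ_smul : ∀ {γ₁ γ₂ : Γ} (a : FA.F γ₁) (m : FM.F γ₂),
    GA.σ γ₁ a • σ γ₂ m = σ (γ₁ * γ₂) ⟨(a : A) • (m : M), FM.smul_mem a.2 m.2⟩

universe z

/-- A K-subspace (e.g. an ideal) of the Γ-graded algebra B is Γ-graded
(homogeneous) if it is spanned by its homogeneous elements. -/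
def IsHomogeneousIdeal {K : Type u} [Field K] {Γ : Type v} {B : Type x} [Ring B]
    [Algebra K B] (grade : Γ → Submodule K B) (S : Submodule K B) : Prop :=
  S = Submodule.span K {x | x ∈ S ∧ ∃ γ : Γ, x ∈ grade γ}

/-- A submodule of the Γ-graded module N is Γ-graded (homogeneous) if it is
spanned by its homogeneous elements. -/
def IsHomogeneousSubmodule {K : Type u} [Field K] {Γ : Type v} {B : Type x} [Ring B]
    [Algebra K B] {N : Type z} [AddCommGroup N] [Module K N] [Module B N]
    (grade : Γ → Submodule K N) (P : Submodule B N) : Prop :=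
  P = Submodule.span B {x | x ∈ P ∧ ∃ γ : Γ, x ∈ grade γ}

open DirectSum

section Leading

variable {R ι M N : Type*} [Ring R] [AddCommGroup M] [Module R M]
  [AddCommGroup N] [Module R N] {F : ι → Submodule R M}

/-- The sum of the images of `P ⊓ F i` under the symbol maps `σ i : F i → N`. -/
def leadingSubmodule (σ : ∀ i, F i →ₗ[R] N) (P : Submodule R M) : Submodule R N :=
  ⨆ i, (P.comap (F i).subtype).map (σ i)

variable {σ : ∀ i, F i →ₗ[R] N} {P : Submodule R M}

theorem symbol_mem_leadingSubmodule {i : ι} {m : F i} (hm : (m : M) ∈ P) :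
    σ i m ∈ leadingSubmodule σ P :=
  Submodule.mem_iSup_of_mem i (Submodule.mem_map_of_mem hm)

@[elab_as_elim]
theorem leadingSubmodule_induction {motive : N → Prop} {x : N} (hx : x ∈ leadingSubmodule σ P)
    (symbol : ∀ i (m : F i), (m : M) ∈ P → motive (σ i m)) (zero : motive 0)
    (add : ∀ x y, motive x → motive y → motive (x + y)) : motive x := by
  refine Submodule.iSup_induction (motive := motive) _ hx ?_ zero add
  rintro i _ ⟨m, hm, rfl⟩
  exact symbol i m hm

theorem exists_lt_mem_of_mem_iSup_lt [LinearOrder ι] (hF : Monotone F) {i : ι} {m : M}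
    (hm : m ∈ ⨆ j < i, F j) : m = 0 ∨ ∃ j < i, m ∈ F j := by
  refine Submodule.iSup_induction (motive := fun m => m = 0 ∨ ∃ j < i, m ∈ F j) _ hm
    (fun j x hx => ?_) (Or.inl rfl) ?_
  · by_cases hj : j < i
    · exact Or.inr ⟨j, hj, by simpa [hj] using hx⟩
    · exact Or.inl (by simpa [hj] using hx)
  · rintro x y (rfl | ⟨j, hj, hx⟩) (rfl | ⟨k, hk, hy⟩)
    · exact Or.inl (add_zero 0)
    · exact Or.inr ⟨k, hk, by rwa [zero_add]⟩
    · exact Or.inr ⟨j, hj, by rwa [add_zero]⟩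
    · exact Or.inr ⟨max j k, max_lt hj hk,
        add_mem (hF (le_max_left j k) hx) (hF (le_max_right j k) hy)⟩

theorem eq_bot_of_leadingSubmodule_eq_bot [LinearOrder ι] [WellFoundedLT ι] (hF : Monotone F)
    (hexh : ∀ m, ∃ i, m ∈ F i) (hker : ∀ i (m : F i), σ i m = 0 → (m : M) ∈ ⨆ j < i, F j)
    (h : leadingSubmodule σ P = ⊥) : P = ⊥ := by
  refine (Submodule.eq_bot_iff P).2 fun m hm => ?_
  obtain ⟨i, hi⟩ := hexh m
  induction i using WellFoundedLT.induction with
  | ind i ih =>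
    have h0 : σ i ⟨m, hi⟩ ∈ leadingSubmodule σ P := symbol_mem_leadingSubmodule hm
    rw [h, Submodule.mem_bot] at h0
    rcases exists_lt_mem_of_mem_iSup_lt hF (hker i _ h0) with h | ⟨j, hj, hmj⟩
    · exact h
    · exact ih j hj hmj

theorem exists_symbol_eq_of_mem_leadingSubmodule [DecidableEq ι] {grade : ι → Submodule R N}
    (hint : DirectSum.IsInternal grade) (hσ : ∀ i m, σ i m ∈ grade i) {i : ι} {x : N}
    (hx : x ∈ leadingSubmodule σ P) (hxi : x ∈ grade i) :
    ∃ m : F i, (m : M) ∈ P ∧ σ i m = x := by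
  let _ := hint.chooseDecomposition
  have key : ((decompose grade x i : grade i) : N) ∈ (P.comap (F i).subtype).map (σ i) := by
    refine leadingSubmodule_induction hx (fun j m hm => ?_) (by simp) fun x y hx hy => ?_
    · by_cases hij : j = i
      · subst hij
        rw [decompose_of_mem_same _ (hσ _ m)]
        exact Submodule.mem_map_of_mem hm
      · rw [decompose_of_mem_ne _ (hσ _ m) hij]
        exact zero_mem _
    · rw [decompose_add]
      exact add_mem hx hy
  rw [decompose_of_mem_same _ hxi] at key
  exact key

theorem eq_top_of_leadingSubmodule_eq_top [LinearOrder ι] [WellFoundedLT ι] [DecidableEq ι]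
    {grade : ι → Submodule R N}
    (hint : DirectSum.IsInternal grade) (hσ : ∀ i m, σ i m ∈ grade i)
    (hexh : ∀ m, ∃ i, m ∈ F i) (hker : ∀ i (m : F i), σ i m = 0 → (m : M) ∈ ⨆ j < i, F j)
    (h : leadingSubmodule σ P = ⊤) : P = ⊤ := by
  have key (i : ι) : F i ≤ P := by
    induction i using WellFoundedLT.induction with
    | ind i ih =>
      intro m hm
      obtain ⟨n, hn, hmn⟩ := exists_symbol_eq_of_mem_leadingSubmodule hint hσ
        (h ▸ Submodule.mem_top : σ i ⟨m, hm⟩ ∈ leadingSubmodule σ P) (hσ i _)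
      have hlt : m - n ∈ ⨆ j < i, F j :=
        hker i (⟨m, hm⟩ - n) (by rw [map_sub, hmn, sub_self])
      exact (P.sub_mem_iff_left hn).1 (iSup₂_le ih hlt)
  refine (Submodule.eq_top_iff').2 fun m => ?_
  obtain ⟨i, hi⟩ := hexh m
  exact key i hi

end Leading

section PositiveDegree

variable {R Γ B : Type*} [CommRing R] [Monoid Γ] [DecidableEq Γ] [Ring B] [Algebra R B]
  {grade : Γ → Submodule R B}

theorem coe_decompose_mul_eq_zero [Decomposition grade]
    (hmul : ∀ {α β : Γ} {x y : B}, x ∈ grade α → y ∈ grade β → x * y ∈ grade (α * β))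
    {x y : B} {γ : Γ} (h : ∀ α β, (decompose grade x α : B) ≠ 0 → (decompose grade y β : B) ≠ 0 →
      α * β ≠ γ) : (decompose grade (x * y) γ : B) = 0 := by
  classical
  rw [← sum_support_decompose grade x, ← sum_support_decompose grade y, Finset.sum_mul_sum]
  simp only [decompose_sum, DirectSum.sum_apply, AddSubmonoidClass.coe_finsetSum]
  refine Finset.sum_eq_zero fun α hα => Finset.sum_eq_zero fun β hβ => ?_
  exact decompose_of_mem_ne _ (hmul (decompose grade x α).2 (decompose grade y β).2)
    (h α β (by simpa using hα) (by simpa using hβ))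

theorem grade_eq_bot_of_isSemisimpleRing [LinearOrder Γ] [MulLeftStrictMono Γ]
    [IsSemisimpleRing B] (hone : ∀ γ : Γ, 1 ≤ γ) (hint : DirectSum.IsInternal grade)
    (hmul : ∀ {α β : Γ} {x y : B}, x ∈ grade α → y ∈ grade β → x * y ∈ grade (α * β))
    {γ : Γ} (hγ : γ ≠ 1) : grade γ = ⊥ := by
  classical
  let _ := hint.chooseDecomposition
  have hlt {β : Γ} (α : Γ) (hβ : β ≠ 1) : α < α * β :=
    lt_mul_of_one_lt_right' α (lt_of_le_of_ne (hone β) hβ.symm)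
  let I : Ideal B :=
    { carrier := {x | (decompose grade x 1 : B) = 0}
      zero_mem' := by simp
      add_mem' := fun {x y} hx hy => by
        simp only [Set.mem_ofPred_eq] at hx hy ⊢
        rw [decompose_add, DirectSum.add_apply, Submodule.coe_add, hx, hy, add_zero]
      smul_mem' := fun b x hx => coe_decompose_mul_eq_zero hmul fun α β _ hβ =>
        ((hone α).trans_lt (hlt α fun h => hβ (by rw [h]; exact hx))).ne' }
  obtain ⟨e, he, hI⟩ := IsSemisimpleRing.ideal_eq_span_idempotent I
  have heI : (decompose grade e 1 : B) = 0 :=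
    (hI ▸ Ideal.mem_span_singleton_self e : e ∈ I)
  have he0 : e = 0 := by
    by_contra hne
    have hs : (decompose grade e).support.Nonempty := by
      rw [Finset.nonempty_iff_ne_empty, Ne, DFinsupp.support_eq_empty]
      exact fun h => hne (by rw [← (decompose grade).symm_apply_apply e, h, decompose_symm_zero])
    set δ := (decompose grade e).support.min' hs with hδ
    have hmin (α : Γ) (hα : (decompose grade e α : B) ≠ 0) : δ ≤ α :=
      Finset.min'_le _ _ (by simpa using hα)
    have hδ0 : (decompose grade e δ : B) ≠ 0 := by
      simpa using Finset.min'_mem _ hs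
    refine hδ0 ?_
    rw [← he.eq]
    exact coe_decompose_mul_eq_zero hmul fun α β hα hβ =>
      ((hmin α hα).trans_lt (hlt α fun h => hβ (by rw [h]; exact heI))).ne'
  refine (Submodule.eq_bot_iff _).2 fun x hx => ?_
  have hxI : x ∈ I := decompose_of_mem_ne _ hx hγ
  rw [hI, he0] at hxI
  simpa using hxI

end PositiveDegree

namespace AssocGraded

variable {k Γ A B : Type*} [Field k] [Monoid Γ] [LinearOrder Γ] [DecidableEq Γ]
  [Ring A] [Algebra k A] {FA : AlgFiltration k Γ A} [Ring B] [Algebra k B]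
  (GA : AssocGraded k Γ FA B)

theorem mul_mem_grade {α β : Γ} {x y : B} (hx : x ∈ GA.grade α) (hy : y ∈ GA.grade β) :
    x * y ∈ GA.grade (α * β) := by
  obtain ⟨a, rfl⟩ := GA.σ_surj α x hx
  obtain ⟨b, rfl⟩ := GA.σ_surj β y hy
  rw [GA.σ_mul]
  exact GA.σ_mem _ _

@[elab_as_elim]
theorem symbol_induction {motive : B → Prop} (b : B)
    (symbol : ∀ γ (a : FA.F γ), motive (GA.σ γ a)) (zero : motive 0)
    (add : ∀ x y, motive x → motive y → motive (x + y)) : motive b := by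
  have hb : b ∈ ⨆ γ, GA.grade γ := GA.internal.submodule_iSup_eq_top ▸ Submodule.mem_top
  refine Submodule.iSup_induction (motive := motive) _ hb (fun γ x hx => ?_) zero add
  obtain ⟨a, rfl⟩ := GA.σ_surj γ x hx
  exact symbol γ a

theorem F_one_eq_top [WellFoundedLT Γ] (h : ∀ γ ≠ 1, GA.grade γ = ⊥) : FA.F 1 = ⊤ := by
  have key (γ : Γ) : FA.F γ ≤ FA.F 1 := by
    induction γ using WellFoundedLT.induction with
    | ind γ ih =>
      intro a ha
      by_cases hγ : γ = 1
      · exact hγ ▸ ha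
      · have h0 : GA.σ γ ⟨a, ha⟩ ∈ (⊥ : Submodule k B) := h γ hγ ▸ GA.σ_mem γ _
        exact (iSup₂_le ih : FA.Fstar γ ≤ FA.F 1) ((GA.σ_ker γ _).1 h0)
  refine (Submodule.eq_top_iff').2 fun a => ?_
  obtain ⟨γ, hγ⟩ := FA.exhaustive a
  exact key γ hγ

theorem symbol_congr {α β : Γ} (h : α = β) {a : A} (ha : a ∈ FA.F α) (hb : a ∈ FA.F β) :
    GA.σ α ⟨a, ha⟩ = GA.σ β ⟨a, hb⟩ := by
  subst h
  rfl

theorem nonempty_ringEquiv [WellFoundedLT Γ] (hone : ∀ γ : Γ, 1 ≤ γ)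
    (h : ∀ γ ≠ 1, GA.grade γ = ⊥) : Nonempty (B ≃+* A) := by
  have hF (a : A) : a ∈ FA.F 1 := GA.F_one_eq_top h ▸ Submodule.mem_top
  let f : A →+* B :=
    { toFun := fun a => GA.σ 1 ⟨a, hF a⟩
      map_one' := GA.σ_one
      map_mul' := fun a b => by
        rw [GA.σ_mul]
        exact GA.symbol_congr (one_mul 1).symm _ _
      map_zero' := map_zero (GA.σ 1)
      map_add' := fun a b => map_add (GA.σ 1) ⟨a, hF a⟩ ⟨b, hF b⟩ }
  refine ⟨(RingEquiv.ofBijective f ⟨(injective_iff_map_eq_zero f).2 fun a ha => ?_,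
    fun b => ?_⟩).symm⟩
  · have hbot : FA.Fstar 1 = ⊥ := by
      simp [AlgFiltration.Fstar, fun γ => (hone γ).not_gt]
    simpa [hbot] using (GA.σ_ker 1 ⟨a, hF a⟩).1 ha
  · induction b using GA.symbol_induction with
    | symbol γ a =>
      by_cases hγ : γ = 1
      · exact ⟨a, GA.symbol_congr hγ.symm _ _⟩
      · have h0 : GA.σ γ a ∈ (⊥ : Submodule k B) := h γ hγ ▸ GA.σ_mem γ a
        exact ⟨0, by rw [map_zero, (Submodule.mem_bot k).1 h0]⟩
    | zero => exact ⟨0, map_zero f⟩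
    | add x y hx hy => exact (f.range).add_mem hx hy

theorem nonempty_ringEquiv_of_isSemisimpleRing (GA : AssocGraded k Γ FA B)
    [MulLeftStrictMono Γ] [WellFoundedLT Γ] (hone : ∀ γ : Γ, 1 ≤ γ) [IsSemisimpleRing B] :
    Nonempty (B ≃+* A) :=
  GA.nonempty_ringEquiv hone fun _ hγ =>
    grade_eq_bot_of_isSemisimpleRing hone GA.internal GA.mul_mem_grade hγ

theorem eq_bot_or_eq_top_of_isTwoSided [WellFoundedLT Γ]
    (hB : ∀ J : Submodule k B, (∀ r : B, ∀ x ∈ J, r * x ∈ J ∧ x * r ∈ J) →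
      IsHomogeneousIdeal GA.grade J → J = ⊥ ∨ J = ⊤)
    (J : Submodule k A) (hJ : ∀ r : A, ∀ x ∈ J, r * x ∈ J ∧ x * r ∈ J) : J = ⊥ ∨ J = ⊤ := by
  have hker (γ : Γ) (a : FA.F γ) : GA.σ γ a = 0 → (a : A) ∈ ⨆ δ < γ, FA.F δ :=
    (GA.σ_ker γ a).1
  refine (hB (leadingSubmodule GA.σ J) (fun r x hx => ?_) (le_antisymm ?_ ?_)).imp
    (eq_bot_of_leadingSubmodule_eq_bot FA.mono FA.exhaustive hker)
    (eq_top_of_leadingSubmodule_eq_top GA.internal GA.σ_mem FA.exhaustive hker)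
  · induction r using GA.symbol_induction with
    | symbol γ a =>
      refine leadingSubmodule_induction hx (fun δ b hb => ?_) (by simp) fun x y hx hy => ?_
      · rw [GA.σ_mul, GA.σ_mul]
        exact ⟨symbol_mem_leadingSubmodule (hJ _ _ hb).1, symbol_mem_leadingSubmodule (hJ _ _ hb).2⟩
      · rw [mul_add, add_mul]
        exact ⟨add_mem hx.1 hy.1, add_mem hx.2 hy.2⟩
    | zero => simp
    | add r s hr hs =>
      rw [mul_add, add_mul]
      exact ⟨add_mem hr.1 hs.1, add_mem hr.2 hs.2⟩
  · intro x hx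
    exact leadingSubmodule_induction hx (fun γ a ha => Submodule.subset_span
      ⟨symbol_mem_leadingSubmodule ha, γ, GA.σ_mem γ a⟩) (zero_mem _) fun _ _ => add_mem
  · exact Submodule.span_le.2 fun x hx => hx.1

end AssocGraded

namespace AssocGradedMod

variable {k Γ A B M N : Type*} [Field k] [Monoid Γ] [LinearOrder Γ] [DecidableEq Γ]
  [Ring A] [Algebra k A] {FA : AlgFiltration k Γ A} [Ring B] [Algebra k B]
  {GA : AssocGraded k Γ FA B} [AddCommGroup M] [Module k M] [Module A M] [IsScalarTower k A M]
  {FM : ModFiltration k Γ FA M} [AddCommGroup N] [Module k N] [Module B N] [IsScalarTower k B N]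
  (GM : AssocGradedMod k Γ GA FM N)

theorem smul_mem_leadingSubmodule (P : Submodule A M) (b : B) {x : N}
    (hx : x ∈ leadingSubmodule GM.σ (P.restrictScalars k)) :
    b • x ∈ leadingSubmodule GM.σ (P.restrictScalars k) := by
  induction b using GA.symbol_induction with
  | symbol γ a =>
    refine leadingSubmodule_induction hx (fun δ m hm => ?_) (by simp) fun x y hx hy => ?_
    · rw [GM.σ_smul]
      exact symbol_mem_leadingSubmodule (P.smul_mem _ hm)
    · rw [smul_add]
      exact add_mem hx hy
  | zero => simp
  | add r s hr hs =>
    rw [add_smul]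
    exact add_mem hr hs

theorem eq_bot_or_eq_top [WellFoundedLT Γ]
    (hN : ∀ P : Submodule B N, IsHomogeneousSubmodule GM.grade P → P = ⊥ ∨ P = ⊤)
    (P : Submodule A M) : P = ⊥ ∨ P = ⊤ := by
  have hker (γ : Γ) (m : FM.F γ) : GM.σ γ m = 0 → (m : M) ∈ ⨆ δ < γ, FM.F δ :=
    (GM.σ_ker γ m).1
  obtain ⟨L, hL⟩ : ∃ L : Submodule B N,
      L.restrictScalars k = leadingSubmodule GM.σ (P.restrictScalars k) :=
    ⟨{ (leadingSubmodule GM.σ (P.restrictScalars k)).toAddSubmonoid with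
      smul_mem' := fun b _ hx => GM.smul_mem_leadingSubmodule P b hx }, rfl⟩
  have hmem {x : N} : x ∈ L ↔ x ∈ leadingSubmodule GM.σ (P.restrictScalars k) := by
    rw [← hL, Submodule.restrictScalars_mem]
  have hhom : IsHomogeneousSubmodule GM.grade L := by
    refine le_antisymm (fun x hx => ?_) (Submodule.span_le.2 fun x hx => hx.1)
    refine leadingSubmodule_induction (hmem.1 hx) (fun γ m hm => ?_) (zero_mem _)
      fun _ _ => add_mem
    exact Submodule.subset_span
      ⟨hmem.2 (symbol_mem_leadingSubmodule hm), γ, GM.σ_mem γ m⟩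
  refine (hN L hhom).imp (fun h => ?_) (fun h => ?_)
  · rw [h, Submodule.restrictScalars_bot] at hL
    exact (Submodule.restrictScalars_eq_bot_iff k A M).1
      (eq_bot_of_leadingSubmodule_eq_bot FM.mono FM.exhaustive hker hL.symm)
  · rw [h, Submodule.restrictScalars_top] at hL
    exact (Submodule.restrictScalars_eq_top_iff k A M).1
      (eq_top_of_leadingSubmodule_eq_top GM.internal GM.σ_mem FM.exhaustive hker hL.symm)

end AssocGradedMod

/-!
STATEMENT 10.  (i) If G(A) is Γ-graded simple (no Γ-graded two-sided ideal
other than 0 and G(A)), then A is a simple K-algebra.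
(ii) If G(M) is a Γ-graded simple G(A)-module, then M is a simple A-module.
(iii) If G(A) is semisimple Artinian then so is A; if G(A) is simple Artinian
then so is A.
-/

theorem statement10 [DecidableEq Γ]
    [CovariantClass Γ Γ (· * ·) (· < ·)] [CovariantClass Γ Γ (swap (· * ·)) (· < ·)]
    [WellFoundedLT Γ] (hone : ∀ γ : Γ, (1 : Γ) ≤ γ)
    {A : Type w} [Ring A] [Algebra K A] (FA : AlgFiltration K Γ A)
    {B : Type x} [Ring B] [Algebra K B] (GA : AssocGraded K Γ FA B) :
    -- (i)
    ((∀ J : Submodule K B, (∀ r : B, ∀ x ∈ J, r * x ∈ J ∧ x * r ∈ J) →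
        IsHomogeneousIdeal GA.grade J → J = ⊥ ∨ J = ⊤) →
      ∀ J : Submodule K A, (∀ r : A, ∀ x ∈ J, r * x ∈ J ∧ x * r ∈ J) →
        J = ⊥ ∨ J = ⊤) ∧
    -- (ii)
    (∀ (M : Type y) (_ : AddCommGroup M) (_ : Module K M) (_ : Module A M)
      (_ : IsScalarTower K A M) (FM : ModFiltration K Γ FA M)
      (N : Type z) (_ : AddCommGroup N) (_ : Module K N) (_ : Module B N)
      (_ : IsScalarTower K B N) (GrM : AssocGradedMod K Γ GA FM N),
      (∀ P : Submodule B N, IsHomogeneousSubmodule GrM.grade P → P = ⊥ ∨ P = ⊤) →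
      ∀ P : Submodule A M, P = ⊥ ∨ P = ⊤) ∧
    -- (iii)
    (IsSemisimpleRing B → IsSemisimpleRing A) ∧
    ((IsSimpleRing B ∧ IsArtinian B B) → (IsSimpleRing A ∧ IsArtinian A A)) := by
  refine ⟨GA.eq_bot_or_eq_top_of_isTwoSided, ?_, fun _ => ?_, fun ⟨_, _⟩ => ?_⟩
  · intro M _ _ _ _ FM N _ _ _ _ GM hN
    exact GM.eq_bot_or_eq_top hN
  · obtain ⟨e⟩ := GA.nonempty_ringEquiv_of_isSemisimpleRing hone
    exact e.isSemisimpleRing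
  · have : IsSemisimpleRing B := IsSimpleRing.isSemisimpleRing_iff_isArtinianRing.2 ‹_›
    obtain ⟨e⟩ := GA.nonempty_ringEquiv_of_isSemisimpleRing hone
    exact ⟨.of_ringEquiv e ‹_›, e.isArtinianRing⟩
end
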